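/- arXiv:1401.7005 — 2 statements merged into one kernel-verified Lean document; each statement's English description precedes it below -/
import Mathlib

section
/- If t₀ ∈ (0,1) satisfies Y(t₀) = 1, then 0.0381910976 < ξ(t₀) < 0.0381910977, where ξ(t) = (3t+1)(1−t)³/(16t³). -/
noncomputable def h1 (t : ℝ) : ℝ := (2*t+1)/((3*t+1)*(1-t))

noncomputable def h2 (t : ℝ) : ℝ :=
  -(t^2*(1-t)*(5*t^2+36*t+18))/(2*(t+3)*(2*t+1)*(3*t+1)^2)

noncomputable def Y (t : ℝ) : ℝ := -1 + h1 t * Real.exp (h2 t)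

noncomputable def xi (t : ℝ) : ℝ := (3*t+1)*(1-t)^3/(16*t^3)

lemma h1_deriv {t : ℝ} (h0 : 0 < t) (h : t < 1) :
    HasDerivAt h1 ((6*t^2+6*t)/((3*t+1)*(1-t))^2) t := by
  have hd : (3*t+1)*(1-t) ≠ 0 := by
    have : 0 < 1 - t := by linarith
    positivity
  have a : HasDerivAt (fun t : ℝ => 2*t+1) 2 t := by
    simpa using ((hasDerivAt_id t).const_mul 2).add_const 1
  have b : HasDerivAt (fun t : ℝ => 3*t+1) 3 t := by
    simpa using ((hasDerivAt_id t).const_mul 3).add_const 1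
  have c : HasDerivAt (fun t : ℝ => 1-t) (-1) t := by
    simpa using (hasDerivAt_id t).const_sub 1
  have := a.div (b.mul c) hd
  refine this.congr_deriv ?_
  simp only [Pi.mul_apply]
  congr 1
  ring

lemma h2_deriv {t : ℝ} (h0 : 0 < t) :
    HasDerivAt h2 ((-108*t-288*t^2+336*t^3+1464*t^4+1158*t^5+240*t^6+30*t^7)
      /(2*(t+3)^2*(2*t+1)^2*(3*t+1)^3)) t := by
  have hd : (2*(t+3)*(2*t+1)*(3*t+1)^2) ≠ 0 := by positivity
  have i := hasDerivAt_id t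
  have a : HasDerivAt (fun t : ℝ => 2*t+1) 2 t := by
    simpa using (i.const_mul 2).add_const 1
  have b : HasDerivAt (fun t : ℝ => 3*t+1) 3 t := by
    simpa using (i.const_mul 3).add_const 1
  have c : HasDerivAt (fun t : ℝ => 1-t) (-1) t := by
    simpa using i.const_sub 1
  have e : HasDerivAt (fun t : ℝ => 2*(t+3)) 2 t := by
    simpa using (i.add_const 3).const_mul 2
  have q : HasDerivAt (fun t : ℝ => t^2) (2*t) t := by
    simpa using i.fun_pow 2
  have b2 : HasDerivAt (fun t : ℝ => (3*t+1)^2) (2*(3*t+1)*3) t := by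
    simpa using b.fun_pow 2
  have f : HasDerivAt (fun t : ℝ => 5*t^2+36*t+18) (5*(2*t)+36) t := by
    simpa using ((q.const_mul 5).add (i.const_mul 36)).add_const 18
  have := (((q.mul c).mul f).neg).div ((e.mul a).mul b2) hd
  refine this.congr_deriv ?_
  simp only [Pi.mul_apply, Pi.neg_apply]
  rw [div_eq_div_iff (by positivity) (by positivity)]
  ring

lemma Y_mono : StrictMonoOn Y (Set.Ioo 0 1) := by
  have key : ∀ t ∈ Set.Ioo (0:ℝ) 1, ∃ y, 0 < y ∧ HasDerivAt Y y t := by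
    rintro t ⟨h0, h⟩
    have hc : 0 < 1 - t := by linarith
    have := ((h1_deriv h0 h).mul (h2_deriv h0).exp).const_add (-1)
    refine ⟨_, ?_, this⟩
    have e : (6*t^2+6*t)/((3*t+1)*(1-t))^2 + h1 t *
      ((-108*t-288*t^2+336*t^3+1464*t^4+1158*t^5+240*t^6+30*t^7)
      /(2*(t+3)^2*(2*t+1)^2*(3*t+1)^3)) =
      (2*t+1)/((3*t+1)*(1-t)) * ((864*t^2+4416*t^3+7536*t^4+4794*t^5+846*t^6+6*t^7-30*t^8)
        /(2*(t+3)^2*(2*t+1)^2*(3*t+1)^3*(1-t))) := by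
      unfold h1
      have := hc.ne'
      field_simp
      ring
    have p : 0 < 864*t^2+4416*t^3+7536*t^4+4794*t^5+846*t^6+6*t^7-30*t^8 := by
      have : t^8 ≤ t^2 := pow_le_pow_of_le_one h0.le h.le (by norm_num)
      have : 0 < 834*t^2+4416*t^3+7536*t^4+4794*t^5+846*t^6+6*t^7 := by positivity
      linarith
    have : 0 < ((6*t^2+6*t)/((3*t+1)*(1-t))^2 + h1 t *
      ((-108*t-288*t^2+336*t^3+1464*t^4+1158*t^5+240*t^6+30*t^7)
      /(2*(t+3)^2*(2*t+1)^2*(3*t+1)^3))) * Real.exp (h2 t) := by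
      rw [e]; positivity
    linarith
  refine strictMonoOn_of_deriv_pos (convex_Ioo 0 1) ?_ ?_
  · intro t ht
    obtain ⟨y, _, hy⟩ := key t ht
    exact hy.continuousAt.continuousWithinAt
  · intro t ht
    rw [interior_Ioo] at ht
    obtain ⟨y, h, hy⟩ := key t ht
    rwa [hy.deriv]

lemma Ya : Y 0.62637166325 < 1 := by
  have hb := Real.exp_bound (x := h2 0.62637166325) (n := 9)
    (by rw [abs_le]; constructor <;> norm_num [h2]) (by norm_num)
  have hb := (abs_le.1 hb).2
  have hx : |h2 0.62637166325| ≤ 0.05 := by rw [abs_le]; constructor <;> norm_num [h2]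
  have hx : |h2 0.62637166325|^9 ≤ 0.05^9 := by gcongr
  have : Real.exp (h2 0.62637166325) < 2 / h1 0.62637166325 := by
    have h : h2 0.62637166325 ^ 0 = 1 := pow_zero _
    norm_num [Finset.sum_range_succ, Nat.factorial, h1, h2] at hb hx ⊢
    linarith
  have hp : 0 < h1 0.62637166325 := by norm_num [h1]
  rw [lt_div_iff₀ hp] at this
  unfold Y; linarith

lemma Yb : 1 < Y 0.6263716634 := by
  have hb := Real.exp_bound (x := h2 0.6263716634) (n := 9)
    (by rw [abs_le]; constructor <;> norm_num [h2]) (by norm_num)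
  have hb := (abs_le.1 hb).1
  have hx : |h2 0.6263716634| ≤ 0.05 := by rw [abs_le]; constructor <;> norm_num [h2]
  have hx : |h2 0.6263716634|^9 ≤ 0.05^9 := by gcongr
  have : 2 / h1 0.6263716634 < Real.exp (h2 0.6263716634) := by
    norm_num [Finset.sum_range_succ, Nat.factorial, h1, h2] at hb hx ⊢
    linarith
  have hp : 0 < h1 0.6263716634 := by norm_num [h1]
  rw [div_lt_iff₀ hp] at this
  unfold Y; linarith

lemma xi_anti {s t : ℝ} (hs : 1/2 ≤ s) (hst : s ≤ t) (ht : t < 1) : xi t ≤ xi s := by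
  have hc : 0 < 1 - t := by linarith
  have h0 : 0 < s := by linarith
  have e : ∀ x : ℝ, xi x = ((3*x+1)*(1-x))*(1-x)^2/(16*x^3) := by intro x; unfold xi; ring
  have k : (3*t+1)*(1-t) ≤ (3*s+1)*(1-s) := by nlinarith
  have : 0 ≤ (3*s+1)*(1-s) := mul_nonneg (by linarith) (by linarith)
  rw [e, e]
  gcongr

theorem xi_at_t0 : ∀ t₀ : ℝ, t₀ ∈ Set.Ioo (0:ℝ) 1 → Y t₀ = 1 →
    0.0381910976 < xi t₀ ∧ xi t₀ < 0.0381910977 := by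
  intro t ht hY
  have a : (0.62637166325:ℝ) < t := by
    rw [← Y_mono.lt_iff_lt (by constructor <;> norm_num) ht, hY]; exact Ya
  have b : t < 0.6263716634 := by
    rw [← Y_mono.lt_iff_lt ht (by constructor <;> norm_num), hY]; exact Yb
  constructor
  · refine lt_of_lt_of_le ?_ (xi_anti (by linarith) b.le (by norm_num))
    norm_num [xi]
  · refine lt_of_le_of_lt (xi_anti (by norm_num) a.le ht.2) ?_
    norm_num [xi]
end

section
/- If t₀ ∈ (0,1) satisfies Y(t₀) = 1 and ν := ξ(t₀) + B₀(t₀) + B₂(t₀), then 0.037439365283 < ν < 0.037439366735. -/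
noncomputable def B0 (t : ℝ) : ℝ :=
  (3*t-1)^2*(t+1)^6*Real.log (t+1)/(512*t^6)
  - (3*t^4-16*t^3+6*t^2-1)*Real.log (3*t+1)/(32*t^3)
  - (3*t+1)^2*(1-t)^6*Real.log (2*t+1)/(1024*t^6)
  + (1/4)*Real.log (t+3) - (1/2)*Real.log t - (3/8)*Real.log 16
  - (217*t^6+920*t^5+972*t^4+1436*t^3+205*t^2-172*t+6)*(1-t)^2/(2048*t^4*(3*t+1)*(t+3))

noncomputable def B2 (t : ℝ) : ℝ :=
  (1-t)^3*(3*t-1)*(3*t+1)*(t+1)^3*Real.log (t+1)/(256*t^6)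
  - (1-t)^3*(3*t+1)*Real.log (3*t+1)/(32*t^3)
  + (3*t+1)^2*(1-t)^6*Real.log (2*t+1)/(512*t^6)
  + (t-1)^4*(185*t^4+698*t^3-217*t^2-160*t+6)/(1024*t^4*(3*t+1)*(t+3))

lemma log_lo (q u : ℝ) (n : ℕ) (hq : 1 ≤ q)
    (h : u ≤ 2 * ∑ i ∈ Finset.range n, ((q-1)/(q+1)) ^ (2 * i + 1) / (2 * i + 1)) :
    u ≤ Real.log q := by
  have h0 : 0 ≤ (q-1)/(q+1) := div_nonneg (by linarith) (by linarith)
  have h1 : (q-1)/(q+1) < 1 := by rw [div_lt_one (by linarith)]; linarith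
  have := Real.sum_range_le_log_div h0 h1 n
  have e : (1 + (q-1)/(q+1)) / (1 - (q-1)/(q+1)) = q := by
    have : q + 1 ≠ 0 := by linarith
    have h2 : 1 + (q-1)/(q+1) = 2*q/(q+1) := by field_simp; ring
    have h3 : 1 - (q-1)/(q+1) = 2/(q+1) := by field_simp; ring
    rw [h2, h3]; field_simp
  rw [e] at this
  linarith

lemma log_hi (q u : ℝ) (n : ℕ) (hq : 1 ≤ q)
    (h : 2 * ((∑ i ∈ Finset.range n, ((q-1)/(q+1)) ^ (2 * i + 1) / (2 * i + 1))
      + ((q-1)/(q+1)) ^ (2 * n + 1) / (1 - ((q-1)/(q+1))^2)) ≤ u) :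
    Real.log q ≤ u := by
  have h0 : 0 ≤ (q-1)/(q+1) := div_nonneg (by linarith) (by linarith)
  have h1 : (q-1)/(q+1) < 1 := by rw [div_lt_one (by linarith)]; linarith
  have := Real.log_div_le_sum_range_add h0 h1 n
  have e : (1 + (q-1)/(q+1)) / (1 - (q-1)/(q+1)) = q := by
    have : q + 1 ≠ 0 := by linarith
    have h2 : 1 + (q-1)/(q+1) = 2*q/(q+1) := by field_simp; ring
    have h3 : 1 - (q-1)/(q+1) = 2/(q+1) := by field_simp; ring
    rw [h2, h3]; field_simp
  rw [e] at this
  linarith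

noncomputable def FF (t : ℝ) : ℝ :=
  Real.log (2*t+1) - Real.log (3*t+1) - Real.log (1-t) + h2 t

lemma FF_deriv (t : ℝ) (h0 : 0 < t) (h1 : t < 1) :
    HasDerivAt FF (t^2*(864+4416*t+7536*t^2+4794*t^3+846*t^4+6*t^5-30*t^6)
      /(2*((t+3)*(2*t+1)*(3*t+1))^2*(3*t+1)*(1-t))) t := by
  have a1 : 2*t+1 ≠ 0 := by positivity
  have a2 : 3*t+1 ≠ 0 := by positivity
  have a3 : 1-t ≠ 0 := by linarith
  have a4 : t+3 ≠ 0 := by positivity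
  have i := hasDerivAt_id' t
  have d1 := ((i.const_mul 2).add_const 1).log a1
  have d2 := ((i.const_mul 3).add_const 1).log a2
  have d3 := (i.const_sub 1).log a3
  have dN : HasDerivAt (fun t : ℝ => -(t^2*(1-t)*(5*t^2+36*t+18)))
      (-(36*t+54*t^2-124*t^3-25*t^4)) t := by
    have := (((i.pow 2).mul (i.const_sub 1)).mul
      ((((i.pow 2).const_mul 5).add (i.const_mul 36)).add_const 18)).neg
    refine this.congr_deriv ?_
    simp
    ring
  have dD : HasDerivAt (fun t : ℝ => 2*(t+3)*(2*t+1)*(3*t+1)^2)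
      (2*(3*t+1)*((2*t+1)*(3*t+1)+2*(t+3)*(3*t+1)+6*(t+3)*(2*t+1))) t := by
    have := ((((i.add_const 3).const_mul 2).mul ((i.const_mul 2).add_const 1))).mul
      (((i.const_mul 3).add_const 1).pow 2)
    refine this.congr_deriv ?_
    simp
    ring
  have d4 := dN.div dD (by positivity)
  have := ((d1.sub d2).sub d3).add d4
  refine this.congr_deriv ?_
  field_simp
  ring

lemma FF_mono : StrictMonoOn FF (Set.Ioo 0 1) := by
  apply strictMonoOn_of_deriv_pos (convex_Ioo 0 1)
  · intro x hx
    exact (FF_deriv x hx.1 hx.2).continuousAt.continuousWithinAt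
  · intro x hx
    rw [interior_Ioo] at hx
    obtain ⟨h0, h1⟩ := hx
    rw [(FF_deriv x h0 h1).deriv]
    have h2 : 0 < 1 - x := by linarith
    have h3 : x^6 ≤ 1 := pow_le_one₀ h0.le h1.le
    have h4 : 0 < 864+4416*x+7536*x^2+4794*x^3+846*x^4+6*x^5-30*x^6 := by
      have : 0 < 4416*x+7536*x^2+4794*x^3+846*x^4+6*x^5 := by positivity
      linarith
    positivity

lemma FF_root (t : ℝ) (h0 : 0 < t) (h1' : t < 1) (h : Y t = 1) : FF t = Real.log 2 := by
  have a3 : 0 < 1-t := by linarith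
  have e : h1 t * Real.exp (h2 t) = 2 := by unfold Y at h; linarith
  rw [← e, Real.log_mul (by unfold h1; positivity) (Real.exp_pos _).ne', Real.log_exp]
  unfold h1 FF
  rw [Real.log_div (by positivity) (by positivity), Real.log_mul (by positivity) (by positivity)]
  ring

lemma FF_form (t : ℝ) (h0 : 0 < t) (h1' : t < 1) :
    FF t = Real.log 2 + Real.log ((2*t+1)/(2*((3*t+1)*(1-t)))) + h2 t := by
  have a3 : 0 < 1-t := by linarith
  unfold FF
  rw [Real.log_div (by positivity) (by positivity), Real.log_mul (by positivity) (by positivity),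
    Real.log_mul (by positivity) (by positivity)]
  ring

lemma FF_a : FF 0.6263716633064 < Real.log 2 := by
  rw [FF_form _ (by norm_num) (by norm_num)]
  have : Real.log ((2*0.6263716633064+1)/(2*((3*0.6263716633064+1)*(1-0.6263716633064))))
      ≤ -h2 0.6263716633064 - 1/10^14 := by
    apply log_hi _ _ 5 (by norm_num)
    unfold h2
    norm_num [Finset.sum_range_succ]
  linarith

lemma FF_b : Real.log 2 < FF 0.6263716633065 := by
  rw [FF_form _ (by norm_num) (by norm_num)]
  have : -h2 0.6263716633065 + 1/10^14 ≤
      Real.log ((2*0.6263716633065+1)/(2*((3*0.6263716633065+1)*(1-0.6263716633065)))) := by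
    apply log_lo _ _ 5 (by norm_num)
    unfold h2
    norm_num [Finset.sum_range_succ]
  linarith

noncomputable def RR (t : ℝ) : ℝ :=
  (2*(t-1)^4*(185*t^4+698*t^3-217*t^2-160*t+6)
    - (217*t^6+920*t^5+972*t^4+1436*t^3+205*t^2-172*t+6)*(1-t)^2)/(2048*t^4*(3*t+1)*(t+3))

lemma nu_form (t : ℝ) (h0 : 0 < t) : xi t + B0 t + B2 t =
    xi t + (1 - xi t^2)/2 * Real.log (t+1) + Real.log (3*t+1)/4 + xi t^2/4 * Real.log (2*t+1)
    + Real.log (t+3)/4 - Real.log t/2 - 3/2*Real.log 2 + RR t := by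
  have e : Real.log 16 = 4 * Real.log 2 := by
    rw [show (16:ℝ) = 2^4 by norm_num, Real.log_pow]; norm_num
  unfold xi B0 B2 RR
  rw [e]
  generalize Real.log (t+1) = l1
  generalize Real.log (3*t+1) = l3
  generalize Real.log (2*t+1) = l2
  generalize Real.log (t+3) = l4
  generalize Real.log t = l0
  generalize Real.log 2 = l
  have a2 : 3*t+1 ≠ 0 := by positivity
  have a4 : t+3 ≠ 0 := by positivity
  field_simp
  ring

lemma log_bds (t : ℝ) (ha : 0.6263716633064 < t) (hb : t < 0.6263716633065) :
    (0.486351560225 ≤ Real.log (t+1) ∧ Real.log (t+1) ≤ 0.486351560226) ∧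
    (1.057482951755 ≤ Real.log (3*t+1) ∧ Real.log (3*t+1) ≤ 1.057482951757) ∧
    (0.812148729798 ≤ Real.log (2*t+1) ∧ Real.log (2*t+1) ≤ 0.812148729800) ∧
    (1.288232606612 ≤ Real.log (t+3) ∧ Real.log (t+3) ≤ 1.288232606613) ∧
    (-0.467811372708 ≤ Real.log t ∧ Real.log t ≤ -0.467811372706) ∧
    (0.693147180559 ≤ Real.log 2 ∧ Real.log 2 ≤ 0.693147180560) := by
  have L : ∀ x y u : ℝ, 0 < x → x ≤ y → u ≤ Real.log x → u ≤ Real.log y :=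
    fun x y u h h' h'' => h''.trans (Real.log_le_log h h')
  have U : ∀ x y u : ℝ, 0 < y → y ≤ x → Real.log x ≤ u → Real.log y ≤ u :=
    fun x y u h h' h'' => (Real.log_le_log h h').trans h''
  refine ⟨⟨?_, ?_⟩, ⟨?_, ?_⟩, ⟨?_, ?_⟩, ⟨?_, ?_⟩, ⟨?_, ?_⟩, ⟨?_, ?_⟩⟩
  · apply L 1.6263716633064 _ _ (by norm_num) (by linarith)
    apply log_lo _ _ 12 (by norm_num); norm_num [Finset.sum_range_succ]
  · apply U 1.6263716633065 _ _ (by linarith) (by linarith)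
    apply log_hi _ _ 12 (by norm_num); norm_num [Finset.sum_range_succ]
  · apply L 2.8791149899192 _ _ (by norm_num) (by linarith)
    apply log_lo _ _ 22 (by norm_num); norm_num [Finset.sum_range_succ]
  · apply U 2.8791149899195 _ _ (by linarith) (by linarith)
    apply log_hi _ _ 22 (by norm_num); norm_num [Finset.sum_range_succ]
  · apply L 2.2527433266128 _ _ (by norm_num) (by linarith)
    apply log_lo _ _ 18 (by norm_num); norm_num [Finset.sum_range_succ]
  · apply U 2.2527433266130 _ _ (by linarith) (by linarith)
    apply log_hi _ _ 18 (by norm_num); norm_num [Finset.sum_range_succ]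
  · apply L 3.6263716633064 _ _ (by norm_num) (by linarith)
    apply log_lo _ _ 28 (by norm_num); norm_num [Finset.sum_range_succ]
  · apply U 3.6263716633065 _ _ (by linarith) (by linarith)
    apply log_hi _ _ 28 (by norm_num); norm_num [Finset.sum_range_succ]
  · apply L 0.6263716633064 _ _ (by norm_num) (by linarith)
    rw [neg_le, ← Real.log_inv]
    apply log_hi _ _ 14 (by norm_num); norm_num [Finset.sum_range_succ]
  · apply U 0.6263716633065 _ _ (by linarith) (by linarith)
    rw [le_neg, ← Real.log_inv]
    apply log_lo _ _ 14 (by norm_num); norm_num [Finset.sum_range_succ]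
  · apply log_lo _ _ 14 (by norm_num); norm_num [Finset.sum_range_succ]
  · apply log_hi _ _ 14 (by norm_num); norm_num [Finset.sum_range_succ]

lemma rat_bds (t : ℝ) (ha : 0.6263716633064 < t) (hb : t < 0.6263716633065) :
    (0.03819109765 ≤ xi t ∧ xi t ≤ 0.03819109769) ∧
    (-0.02448277235 ≤ RR t ∧ RR t ≤ -0.02448277227) := by
  have h0 : 0 < t := by linarith
  have L : ∀ n : ℕ, (0.6263716633064:ℝ)^n ≤ t^n := fun n => pow_le_pow_left₀ (by norm_num) ha.le n
  have U : ∀ n : ℕ, t^n ≤ (0.6263716633065:ℝ)^n := fun n => pow_le_pow_left₀ h0.le hb.le n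
  have l2 := L 2
  have l3 := L 3
  have l4 := L 4
  have l5 := L 5
  have l6 := L 6
  have l7 := L 7
  have l8 := L 8
  have u2 := U 2
  have u3 := U 3
  have u4 := U 4
  have u5 := U 5
  have u6 := U 6
  have u7 := U 7
  have u8 := U 8
  clear L U
  norm_num at *
  unfold xi RR
  refine ⟨⟨?_, ?_⟩, ⟨?_, ?_⟩⟩
  · rw [le_div_iff₀ (by positivity)]
    linarith
  · rw [div_le_iff₀ (by positivity)]
    linarith
  · rw [neg_le, ← neg_div, div_le_iff₀ (by positivity)]
    linarith
  · rw [le_neg, ← neg_div, le_div_iff₀ (by positivity)]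
    linarith

theorem nu_bounds : ∀ t₀ : ℝ, t₀ ∈ Set.Ioo (0:ℝ) 1 → Y t₀ = 1 →
    ∀ ν : ℝ, ν = xi t₀ + B0 t₀ + B2 t₀ →
    0.037439365283 < ν ∧ ν < 0.037439366735 := by
  intro t ht hY ν hν
  have hF := FF_root t ht.1 ht.2 hY
  have ha : 0.6263716633064 < t := by
    rw [← FF_mono.lt_iff_lt ⟨by norm_num, by norm_num⟩ ht, hF]
    exact FF_a
  have hb : t < 0.6263716633065 := by
    rw [← FF_mono.lt_iff_lt ht ⟨by norm_num, by norm_num⟩, hF]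
    exact FF_b
  rw [nu_form t ht.1] at hν
  obtain ⟨⟨p1, q1⟩, ⟨p3, q3⟩, ⟨p2, q2⟩, ⟨p4, q4⟩, ⟨p0, q0⟩, ⟨p, q⟩⟩ := log_bds t ha hb
  obtain ⟨⟨w1, w2⟩, ⟨r1, r2⟩⟩ := rat_bds t ha hb
  generalize Real.log (t+1) = x1 at *
  generalize Real.log (3*t+1) = x3 at *
  generalize Real.log (2*t+1) = x2 at *
  generalize Real.log (t+3) = x4 at *
  generalize Real.log t = x0 at *
  generalize Real.log 2 = x at *
  generalize xi t = w at *
  generalize RR t = r at *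
  have s1 : (0.03819109765:ℝ)^2 ≤ w^2 := pow_le_pow_left₀ (by norm_num) w1 2
  have s2 : w^2 ≤ (0.03819109769:ℝ)^2 := pow_le_pow_left₀ (by linarith) w2 2
  have e1 : 0.03819109765^2 * 0.486351560225 ≤ w^2 * x1 :=
    mul_le_mul s1 p1 (by norm_num) (by positivity)
  have e2 : w^2 * x1 ≤ 0.03819109769^2 * 0.486351560226 :=
    mul_le_mul s2 q1 (by linarith) (by positivity)
  have e3 : 0.03819109765^2 * 0.812148729798 ≤ w^2 * x2 :=
    mul_le_mul s1 p2 (by norm_num) (by positivity)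
  have e4 : w^2 * x2 ≤ 0.03819109769^2 * 0.812148729800 :=
    mul_le_mul s2 q2 (by linarith) (by positivity)
  have hν' : ν = w + x1/2 - (w^2*x1)/2 + x3/4 + (w^2*x2)/4 + x4/4 - x0/2 - 3/2*x + r := by
    rw [hν]; ring
  norm_num at e1 e2 e3 e4
  constructor <;> linarith
end
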